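/- Single-layer discretization of the continuous layer map (intermediate claim in the proof of Theorem 1): Let 𝓦 : [0,1)² → ℝ be uniformly continuous and bounded, ς : [0,1)×ℝ → ℝ be uniformly continuous, and 𝒵 : [0,1) → ℝ be uniformly continuous and bounded. Then for every ε > 0 there exists an integer n̄ such that for every n ≥ n̄, setting Δτ = 1/n, one has for all j ∈ {0,…,n−1} and all τ ∈ [j·Δτ, (j+1)·Δτ): | Σ_{i=0}^{n−1} ς(j·Δτ, 𝓦(j·Δτ, i·Δτ)·𝒵(i·Δτ))·Δτ − ∫₀¹ ς(τ, 𝓦(τ,s)·𝒵(s)) ds | ≤ ε. -/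

import Mathlib

/-!
Statement 17: Single-layer discretization of the continuous layer map (intermediate claim in
the proof of Theorem 1).
-/

open MeasureTheory

noncomputable section

lemma unif_aux
    (𝓦 : ℝ → ℝ → ℝ) (ς : ℝ → ℝ → ℝ) (𝒵 : ℝ → ℝ)
    (h𝓦 : UniformContinuousOn (fun x : ℝ × ℝ => 𝓦 x.1 x.2) (Set.Ico 0 1 ×ˢ Set.Ico 0 1))
    (h𝓦b : ∃ M : ℝ, ∀ τ ∈ Set.Ico (0:ℝ) 1, ∀ s ∈ Set.Ico (0:ℝ) 1, |𝓦 τ s| ≤ M)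
    (hς : UniformContinuousOn (fun x : ℝ × ℝ => ς x.1 x.2) (Set.Ico 0 1 ×ˢ Set.univ))
    (h𝒵 : UniformContinuousOn 𝒵 (Set.Ico 0 1))
    (h𝒵b : ∃ M : ℝ, ∀ s ∈ Set.Ico (0:ℝ) 1, |𝒵 s| ≤ M) (ε : ℝ) (hε : 0 < ε) :
    ∃ δ > 0, ∀ τ ∈ Set.Ico (0:ℝ) 1, ∀ τ' ∈ Set.Ico (0:ℝ) 1, ∀ s ∈ Set.Ico (0:ℝ) 1,
      ∀ s' ∈ Set.Ico (0:ℝ) 1, |τ - τ'| < δ → |s - s'| < δ →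
      |ς τ (𝓦 τ s * 𝒵 s) - ς τ' (𝓦 τ' s' * 𝒵 s')| < ε := by
  obtain ⟨M, hM⟩ := h𝓦b
  obtain ⟨N, hN⟩ := h𝒵b
  rw [Metric.uniformContinuousOn_iff] at *
  obtain ⟨d, hd, H⟩ := hς ε hε
  have h0 : (0:ℝ) ∈ Set.Ico (0:ℝ) 1 := by simp
  have hM0 : 0 ≤ M := (abs_nonneg _).trans (hM 0 h0 0 h0)
  have hN0 : 0 ≤ N := (abs_nonneg _).trans (hN 0 h0)
  have hη : 0 < d / (M + N + 1) := by positivity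
  obtain ⟨a, ha, HW⟩ := h𝓦 _ hη
  obtain ⟨b, hb, HZ⟩ := h𝒵 _ hη
  refine ⟨min d (min a b), by positivity, ?_⟩
  intro τ hτ τ' hτ' s hs s' hs' h1 h2
  simp only [lt_min_iff] at h1 h2
  have e1 := HW (τ, s) ⟨hτ, hs⟩ (τ', s') ⟨hτ', hs'⟩ (by
    rw [Prod.dist_eq]; exact max_lt h1.2.1 h2.2.1)
  have e2 := HZ s hs s' hs' h2.2.2
  rw [Real.dist_eq] at e1 e2
  simp only at e1
  refine H (τ, 𝓦 τ s * 𝒵 s) ⟨hτ, trivial⟩ (τ', 𝓦 τ' s' * 𝒵 s') ⟨hτ', trivial⟩ ?_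
  rw [Prod.dist_eq]
  refine max_lt h1.1 ?_
  simp only [Real.dist_eq]
  have : 𝓦 τ s * 𝒵 s - 𝓦 τ' s' * 𝒵 s' =
    (𝓦 τ s - 𝓦 τ' s') * 𝒵 s + 𝓦 τ' s' * (𝒵 s - 𝒵 s') := by ring
  rw [this]
  calc _ ≤ |𝓦 τ s - 𝓦 τ' s'| * |𝒵 s| + |𝓦 τ' s'| * |𝒵 s - 𝒵 s'| := by
        rw [← abs_mul, ← abs_mul]; exact abs_add_le _ _
    _ ≤ d / (M + N + 1) * N + M * (d / (M + N + 1)) := by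
        gcongr
        · exact hN s hs
        · exact hM _ hτ' _ hs'
    _ < d := by
        have : d = d / (M + N + 1) * (M + N + 1) := by field_simp
        nlinarith

lemma riemann_aux (g : ℝ → ℝ) (c : ℕ → ℝ) (n : ℕ) (hn : 0 < n) (ε : ℝ)
    (hg : ContinuousOn g (Set.Ico 0 1))
    (h : ∀ i < n, ∀ s ∈ Set.Ico ((i:ℝ) / n) (((i + 1 : ℕ) : ℝ) / n), |c i - g s| ≤ ε) :
    |(∑ i ∈ Finset.range n, c i * (1 / n)) - ∫ s in Set.Ico (0:ℝ) 1, g s| ≤ ε := by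
  have hn' : (0:ℝ) < n := by exact_mod_cast hn
  have hle : ∀ i : ℕ, (i:ℝ) / n ≤ ((i + 1 : ℕ) : ℝ) / n := fun i => by
    gcongr; simp
  have hlen : ∀ i : ℕ, ((i + 1 : ℕ) : ℝ) / n - (i:ℝ) / n = 1 / n := fun i => by
    push_cast; ring
  have hsub : ∀ i < n, Set.Ico ((i:ℝ) / n) (((i + 1 : ℕ) : ℝ) / n) ⊆ Set.Ico 0 1 := by
    intro i hi
    apply Set.Ico_subset_Ico
    · positivity
    · rw [div_le_one hn']; exact_mod_cast hi
  have hint : ∀ i < n, IntegrableOn g (Set.Ico ((i:ℝ) / n) (((i + 1 : ℕ) : ℝ) / n)) := by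
    intro i hi
    refine IntegrableOn.of_bound (by simp) ((hg.mono (hsub i hi)).aestronglyMeasurable
      measurableSet_Ico) (|c i| + ε) ?_
    refine (ae_restrict_iff' measurableSet_Ico).2 (Filter.Eventually.of_forall fun s hs => ?_)
    have := h i hi s hs
    rw [Real.norm_eq_abs]
    have h2 := abs_sub_abs_le_abs_sub (g s) (c i)
    rw [abs_sub_comm] at h2
    linarith
  have key := intervalIntegral.sum_integral_adjacent_intervals (μ := volume) (f := g)
    (a := fun i : ℕ => (i:ℝ) / n) (n := n) (fun i hi =>
      (intervalIntegrable_iff_integrableOn_Ico_of_le (hle i)).2 (hint i hi))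
  have e : ∫ s in Set.Ico (0:ℝ) 1, g s = ∫ s in (((0:ℕ):ℝ) / n)..((n:ℝ) / n), g s := by
    rw [div_self hn'.ne', Nat.cast_zero, zero_div, intervalIntegral.integral_of_le zero_le_one,
      integral_Ico_eq_integral_Ioc]
  rw [e, ← key, ← Finset.sum_sub_distrib]
  refine (Finset.abs_sum_le_sum_abs _ _).trans ?_
  have : ∀ i ∈ Finset.range n, |c i * (1 / n) -
      ∫ s in ((i:ℝ) / n)..(((i + 1 : ℕ):ℝ) / n), g s| ≤ ε * (1 / n) := by
    intro i hi
    have hi := Finset.mem_range.1 hi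
    have vol : volume.real (Set.Ico ((i:ℝ) / n) (((i + 1 : ℕ) : ℝ) / n)) = 1 / n := by
      rw [Real.volume_real_Ico_of_le (hle i), hlen]
    rw [intervalIntegral.integral_of_le (hle i), ← integral_Ico_eq_integral_Ioc]
    have : c i * (1 / n) = ∫ s in Set.Ico ((i:ℝ) / n) (((i + 1 : ℕ) : ℝ) / n), c i := by
      rw [setIntegral_const, vol, smul_eq_mul, mul_comm]
    rw [this, ← integral_sub (integrable_const _) (hint i hi), ← vol,
      ← Real.norm_eq_abs]
    exact norm_setIntegral_le_of_norm_le_const (by simp) (fun s hs => h i hi s hs)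
  refine (Finset.sum_le_sum this).trans ?_
  simp
  field_simp
  rfl

/-- The Riemann sum over `n` cells of the discretized layer map, with weights frozen at the
grid points, approximates the integral layer map of a continuous neural network, uniformly
over the cell containing `τ`. -/
theorem single_layer_discretization
    (𝓦 : ℝ → ℝ → ℝ) (ς : ℝ → ℝ → ℝ) (𝒵 : ℝ → ℝ)
    (h𝓦 : UniformContinuousOn (fun x : ℝ × ℝ => 𝓦 x.1 x.2) (Set.Ico 0 1 ×ˢ Set.Ico 0 1))
    (h𝓦b : ∃ M : ℝ, ∀ τ ∈ Set.Ico (0:ℝ) 1, ∀ s ∈ Set.Ico (0:ℝ) 1, |𝓦 τ s| ≤ M)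
    (hς : UniformContinuousOn (fun x : ℝ × ℝ => ς x.1 x.2) (Set.Ico 0 1 ×ˢ Set.univ))
    (h𝒵 : UniformContinuousOn 𝒵 (Set.Ico 0 1))
    (h𝒵b : ∃ M : ℝ, ∀ s ∈ Set.Ico (0:ℝ) 1, |𝒵 s| ≤ M) :
    ∀ ε > (0:ℝ), ∃ nbar : ℕ, ∀ n ≥ nbar,
      ∀ j < n, ∀ τ ∈ Set.Ico ((j : ℝ) * (1 / n)) (((j : ℝ) + 1) * (1 / n)),
        |(∑ i ∈ Finset.range n,
            ς ((j : ℝ) / n) (𝓦 ((j : ℝ) / n) ((i : ℝ) / n) * 𝒵 ((i : ℝ) / n)) * (1 / n)) -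
          ∫ s in Set.Ico (0:ℝ) 1, ς τ (𝓦 τ s * 𝒵 s)| ≤ ε := by
  intro ε hε
  obtain ⟨δ, hδ, H⟩ := unif_aux 𝓦 ς 𝒵 h𝓦 h𝓦b hς h𝒵 h𝒵b ε hε
  obtain ⟨N, hN⟩ := exists_nat_gt (1 / δ)
  refine ⟨N, fun n hn j hj τ hτ => ?_⟩
  have hn0 : 0 < n := by omega
  have hn' : (0:ℝ) < n := by exact_mod_cast hn0
  have hnδ : 1 / (n:ℝ) < δ := by
    rw [div_lt_comm₀ hn' hδ]
    exact hN.trans_le (by exact_mod_cast hn)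
  have hmem : ∀ i < n, (i:ℝ) / n ∈ Set.Ico (0:ℝ) 1 := fun i hi =>
    ⟨by positivity, by rw [div_lt_one hn']; exact_mod_cast hi⟩
  have cell : ∀ i < n, ∀ s ∈ Set.Ico ((i:ℝ) / n) (((i + 1 : ℕ) : ℝ) / n),
      s ∈ Set.Ico (0:ℝ) 1 ∧ |(i:ℝ) / n - s| < δ := by
    intro i hi s hs
    have h1 : ((i + 1 : ℕ) : ℝ) / n ≤ 1 := by
      rw [div_le_one hn']; exact_mod_cast hi
    have h2 : ((i + 1 : ℕ) : ℝ) / n = (i:ℝ) / n + 1 / n := by push_cast; ring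
    refine ⟨⟨(hmem i hi).1.trans hs.1, hs.2.trans_le h1⟩, ?_⟩
    rw [abs_lt]
    constructor <;> linarith [hs.1, hs.2]
  have hτc := cell j hj τ (by
    rw [mul_one_div, mul_one_div] at hτ
    exact_mod_cast hτ)
  refine riemann_aux (fun s => ς τ (𝓦 τ s * 𝒵 s))
    (fun i => ς ((j : ℝ) / n) (𝓦 ((j : ℝ) / n) ((i : ℝ) / n) * 𝒵 ((i : ℝ) / n))) n hn0 ε ?_ ?_
  · have hW : ContinuousOn (fun s => 𝓦 τ s) (Set.Ico 0 1) :=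
      h𝓦.continuousOn.comp (f := fun s : ℝ => (τ, s)) (by fun_prop) (fun s hs => ⟨hτc.1, hs⟩)
    exact hς.continuousOn.comp (f := fun s : ℝ => (τ, 𝓦 τ s * 𝒵 s))
      (continuousOn_const.prodMk (hW.mul h𝒵.continuousOn)) (fun s hs => ⟨hτc.1, trivial⟩)
  · intro i hi s hs
    have := cell i hi s hs
    exact (H _ (hmem j hj) _ hτc.1 _ (hmem i hi) _ this.1 hτc.2 this.2).le
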